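/- For every n ≥ 2, the lattice of lower sets (down-closed subsets, ordered by inclusion) of the tetrahedral poset Tetr_n is order-isomorphic to the lattice ASM_n of n×n alternating sign matrices under the partial-sum order. -/

import Mathlib

namespace ASMPaper

/-- The nonzero entries of a vector (a row or a column of a matrix) alternate in sign:
any two nonzero entries with only zero entries strictly between them have opposite values. -/
def Alternating {n : ℕ} (v : Fin n → ℤ) : Prop :=
  ∀ j₁ j₂ : Fin n, j₁ < j₂ → v j₁ ≠ 0 → v j₂ ≠ 0 →
    (∀ j, j₁ < j → j < j₂ → v j = 0) → v j₂ = - v j₁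

/-- `A` is an alternating sign matrix: entries in `{-1,0,1}`, all row and column sums
equal to `1`, and the nonzero entries in each row and column alternate in sign. -/
def IsASM {n : ℕ} (A : Matrix (Fin n) (Fin n) ℤ) : Prop :=
  (∀ i j, A i j = -1 ∨ A i j = 0 ∨ A i j = 1) ∧
  (∀ i, ∑ j, A i j = 1) ∧
  (∀ j, ∑ i, A i j = 1) ∧
  (∀ i, Alternating (fun j => A i j)) ∧
  (∀ j, Alternating (fun i => A i j))

/-- The partial sum `C(A)_{kl} = ∑_{i ≤ k, j ≤ l} A_{ij}`. -/
def Csum {n : ℕ} (A : Matrix (Fin n) (Fin n) ℤ) (k l : Fin n) : ℤ :=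
  ∑ i ∈ Finset.Iic k, ∑ j ∈ Finset.Iic l, A i j

/-- The partial-sum (Bruhat) order on alternating sign matrices:
`A ≤ B` iff all partial sums of `A` are at least those of `B`. -/
def asmLe {n : ℕ} (A B : Matrix (Fin n) (Fin n) ℤ) : Prop :=
  ∀ k l, Csum B k l ≤ Csum A k l

end ASMPaper

namespace ASMPaper

/-- The permutation matrix of `x`: `[x]_{ij} = 1` if `x j = i` and `0` otherwise. -/
def permMat {n : ℕ} (x : Equiv.Perm (Fin n)) : Matrix (Fin n) (Fin n) ℤ :=
  Matrix.of fun i j => if x j = i then 1 else 0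

/-- The Bruhat order on permutations, via entrywise comparison of partial sums of
permutation matrices. -/
def bruhatLe {n : ℕ} (x y : Equiv.Perm (Fin n)) : Prop :=
  ∀ k l, Csum (permMat y) k l ≤ Csum (permMat x) k l

/-- The set of descents of a permutation `w` of `Fin n`: 0-indexed positions `i` with
`i + 1 < n` and `w (i+1) < w i`. -/
def descents {n : ℕ} (w : Equiv.Perm (Fin n)) : Finset ℕ :=
  (Finset.range (n - 1)).filter
    (fun i => ∀ h : i + 1 < n, w ⟨i + 1, h⟩ < w ⟨i, Nat.lt_of_succ_lt h⟩)

/-- A permutation is bigrassmannian if it and its inverse each have exactly one descent. -/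
def Bigrassmannian {n : ℕ} (w : Equiv.Perm (Fin n)) : Prop :=
  (descents w).card = 1 ∧ (descents w⁻¹).card = 1

/-- The underlying set of the tetrahedral poset `Tetr_n`:
triples `(i, j, g(i,j,k))` with `1 ≤ i, j ≤ n-1`, `0 ≤ k ≤ d(i,j)`, where
`d(i,j) = min{i, j, n-i, n-j} - 1` and `g(i,j,k) = (n-1)(n-2)/2 - |i-j| - 2k`. -/
def TetrSet (n : ℕ) : Set (ℤ × ℤ × ℤ) :=
  {p | ∃ i j k : ℤ, 1 ≤ i ∧ i ≤ (n : ℤ) - 1 ∧ 1 ≤ j ∧ j ≤ (n : ℤ) - 1 ∧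
    0 ≤ k ∧ k ≤ min (min i j) (min ((n : ℤ) - i) ((n : ℤ) - j)) - 1 ∧
    p = (i, j, ((n : ℤ) - 1) * ((n : ℤ) - 2) / 2 - |i - j| - 2 * k)}

/-- The generating relations of the tetrahedral poset: `(i,j,g) ≤ (i±1, j, g+1)` and
`(i,j,g) ≤ (i, j±1, g+1)`, imposed whenever both triples belong to `Tetr_n`. -/
def tetrStep (n : ℕ) (p q : ℤ × ℤ × ℤ) : Prop :=
  p ∈ TetrSet n ∧ q ∈ TetrSet n ∧ q.2.2 = p.2.2 + 1 ∧
    ((q.2.1 = p.2.1 ∧ (q.1 = p.1 + 1 ∨ q.1 = p.1 - 1)) ∨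
     (q.1 = p.1 ∧ (q.2.1 = p.2.1 + 1 ∨ q.2.1 = p.2.1 - 1)))

/-- The order of the tetrahedral poset: the reflexive-transitive closure of the
generating relations. -/
def tetrLe (n : ℕ) : ℤ × ℤ × ℤ → ℤ × ℤ × ℤ → Prop :=
  Relation.ReflTransGen (tetrStep n)

end ASMPaper

namespace ASMPaper

/-- `U` is a lower set (down-closed subset) of the tetrahedral poset `Tetr_n`. -/
def IsLowerSetTetr (n : ℕ) (U : Set (ℤ × ℤ × ℤ)) : Prop :=
  U ⊆ TetrSet n ∧ ∀ p q : ℤ × ℤ × ℤ, tetrLe n p q → q ∈ U → p ∈ U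

end ASMPaper

namespace ASMPaper

open Finset

/-! ### Alternating vectors and their prefix sums -/

/-- The extension of a finite vector by zero. -/
def extendZero {n : ℕ} (v : Fin n → ℤ) (j : ℕ) : ℤ :=
  if h : j < n then v ⟨j, h⟩ else 0

lemma extendZero_val {n : ℕ} (v : Fin n → ℤ) (j : Fin n) : extendZero v j = v j := by
  simp [extendZero]

lemma sum_range_extendZero {n : ℕ} (v : Fin n → ℤ) :
    ∑ j ∈ range n, extendZero v j = ∑ j, v j := by
  simp [Finset.sum_range, extendZero_val]

lemma sum_Iic_eq_sum_range_extendZero {n : ℕ} (v : Fin n → ℤ) (k : Fin n) :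
    ∑ j ∈ Iic k, v j = ∑ j ∈ range (k + 1), extendZero v j := by
  have h : range ((k : ℕ) + 1) = (Iic k).map Fin.valEmbedding := by
    rw [Fin.map_valEmbedding_Iic]
    ext x
    simp
  rw [h, Finset.sum_map]
  simp [extendZero_val]

/-- Alternation of signs for infinite sequences. -/
def SeqAlternating (w : ℕ → ℤ) : Prop :=
  ∀ i j, i < j → w i ≠ 0 → w j ≠ 0 → (∀ k, i < k → k < j → w k = 0) → w j = - w i

lemma Alternating.seqAlternating_extendZero {n : ℕ} {v : Fin n → ℤ} (hv : Alternating v) :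
    SeqAlternating (extendZero v) := by
  intro i j hij hi hj hz
  have hin : i < n := by
    by_contra h
    simp [extendZero, h] at hi
  have hjn : j < n := by
    by_contra h
    simp [extendZero, h] at hj
  have := hv ⟨i, hin⟩ ⟨j, hjn⟩ hij (by simpa [extendZero, hin] using hi)
    (by simpa [extendZero, hjn] using hj) (fun k hk hk' => by
      simpa [extendZero_val] using hz k hk hk')
  simpa [extendZero, hin, hjn] using this

lemma SeqAlternating.shift {w : ℕ → ℤ} (hw : SeqAlternating w) (a : ℕ) :
    SeqAlternating fun i => w (a + i) := by
  intro i j hij hi hj hz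
  refine hw (a + i) (a + j) (by omega) hi hj fun k hk hk' => ?_
  simpa [show a + (k - a) = k by omega] using hz (k - a) (by omega) (by omega)

lemma SeqAlternating.sum_range_mem {w : ℕ → ℤ} (hw : SeqAlternating w)
    (hb : ∀ i, w i = -1 ∨ w i = 0 ∨ w i = 1) (l : ℕ) :
    -1 ≤ ∑ i ∈ range l, w i ∧ ∑ i ∈ range l, w i ≤ 1 := by
  have key : ((∀ i < l, w i = 0) ∧ ∑ i ∈ range l, w i = 0) ∨
      ∃ m < l, w m ≠ 0 ∧ (∀ i, m < i → i < l → w i = 0) ∧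
        (∑ i ∈ range l, w i = 0 ∨ ∑ i ∈ range l, w i = w m) := by
    induction l with
    | zero => left; simp
    | succ l ih =>
      rw [Finset.sum_range_succ]
      by_cases h0 : w l = 0
      · rcases ih with ⟨hz, hs⟩ | ⟨m, hm, hne, hz, hs⟩
        · left
          refine ⟨fun i hi => ?_, by simp [hs, h0]⟩
          rcases Nat.lt_succ_iff_lt_or_eq.1 hi with h | rfl
          exacts [hz i h, h0]
        · right
          refine ⟨m, by omega, hne, fun i hi hi' => ?_, by simpa [h0] using hs⟩
          rcases Nat.lt_succ_iff_lt_or_eq.1 hi' with h | rfl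
          exacts [hz i hi h, h0]
      · right
        refine ⟨l, by omega, h0, fun i hi hi' => by omega, ?_⟩
        rcases ih with ⟨hz, hs⟩ | ⟨m, hm, hne, hz, hs⟩
        · right; simp [hs]
        · have := hw m l hm hne h0 hz
          omega
  rcases key with ⟨-, h⟩ | ⟨m, -, -, -, h⟩
  · omega
  · have := hb m
    omega

lemma Alternating.prefix_sum_mem {n : ℕ} {v : Fin n → ℤ} (hv : Alternating v)
    (hb : ∀ i, v i = -1 ∨ v i = 0 ∨ v i = 1) (hs : ∑ i, v i = 1) {l : ℕ} (hl : l ≤ n) :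
    0 ≤ ∑ i ∈ range l, extendZero v i ∧ ∑ i ∈ range l, extendZero v i ≤ 1 := by
  have hb' : ∀ i, extendZero v i = -1 ∨ extendZero v i = 0 ∨ extendZero v i = 1 := by
    intro i
    by_cases h : i < n
    · simpa [extendZero, h] using hb ⟨i, h⟩
    · simp [extendZero, h]
  have h1 := hv.seqAlternating_extendZero.sum_range_mem hb' l
  have h2 := (hv.seqAlternating_extendZero.shift l).sum_range_mem (fun i => hb' _) (n - l)
  have h3 := Finset.sum_range_add (extendZero v) l (n - l)
  rw [Nat.add_sub_cancel' hl, sum_range_extendZero, hs] at h3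
  omega

lemma alternating_of_prefix_sum_mem {n : ℕ} {v : Fin n → ℤ}
    (h : ∀ l ≤ n, 0 ≤ ∑ i ∈ range l, extendZero v i ∧ ∑ i ∈ range l, extendZero v i ≤ 1) :
    Alternating v := by
  intro i j hij hi hj hz
  have hmid : ∑ k ∈ range j, extendZero v k = ∑ k ∈ range (i + 1), extendZero v k := by
    symm
    refine Finset.sum_subset (fun k hk => ?_) fun k hk hk' => ?_
    · simp only [Finset.mem_range] at hk ⊢
      omega
    · simp only [Finset.mem_range] at hk hk'
      have hkn : k < n := by omega
      simpa [extendZero, hkn] using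
        hz ⟨k, hkn⟩ (Fin.lt_def.2 (by simp; omega)) (Fin.lt_def.2 (by simpa using hk))
  have a1 := h i (by omega)
  have a2 := h (i + 1) (by omega)
  have a3 := h j (by omega)
  have a4 := h (j + 1) (by omega)
  rw [Finset.sum_range_succ, extendZero_val] at a2 a4
  rw [Finset.sum_range_succ, extendZero_val] at hmid
  omega

/-! ### Corner sum matrices -/

/-- The entries of a matrix, extended by zero. -/
def entry {n : ℕ} (A : Matrix (Fin n) (Fin n) ℤ) (i j : ℕ) : ℤ :=
  extendZero (fun i' => extendZero (A i') j) i

/-- The sum of the entries of the upper left `k × l` corner. -/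
def cornerSum {n : ℕ} (A : Matrix (Fin n) (Fin n) ℤ) (k l : ℕ) : ℤ :=
  ∑ i ∈ range k, ∑ j ∈ range l, entry A i j

lemma entry_of_lt {n : ℕ} (A : Matrix (Fin n) (Fin n) ℤ) {i : ℕ} (hi : i < n) (j : ℕ) :
    entry A i j = extendZero (A ⟨i, hi⟩) j := by
  simp [entry, extendZero, hi]

lemma entry_val {n : ℕ} (A : Matrix (Fin n) (Fin n) ℤ) (i j : Fin n) :
    entry A i j = A i j := by
  simp [entry, extendZero]

lemma entry_transpose {n : ℕ} (A : Matrix (Fin n) (Fin n) ℤ) (i j : ℕ) :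
    entry A.transpose i j = entry A j i := by
  by_cases hi : i < n <;> by_cases hj : j < n <;> simp [entry, extendZero, hi, hj]

lemma cornerSum_transpose {n : ℕ} (A : Matrix (Fin n) (Fin n) ℤ) (k l : ℕ) :
    cornerSum A.transpose k l = cornerSum A l k := by
  simp only [cornerSum, entry_transpose]
  exact Finset.sum_comm

lemma cornerSum_succ_left {n : ℕ} (A : Matrix (Fin n) (Fin n) ℤ) (k l : ℕ) :
    cornerSum A (k + 1) l = cornerSum A k l + ∑ j ∈ range l, entry A k j :=
  Finset.sum_range_succ _ _

lemma Csum_eq_cornerSum {n : ℕ} (A : Matrix (Fin n) (Fin n) ℤ) (k l : Fin n) :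
    Csum A k l = cornerSum A (k + 1) (l + 1) := by
  simp only [Csum, cornerSum, sum_Iic_eq_sum_range_extendZero]
  refine Finset.sum_congr rfl fun i hi => ?_
  have hi' : i < n := by
    have := Finset.mem_range.1 hi
    omega
  rw [extendZero, dif_pos hi']
  exact Finset.sum_congr rfl fun j _ => (entry_of_lt A hi' j).symm

/-- The functions on `{0, …, n}²` arising as corner sums of alternating sign matrices. -/
structure IsCornerSum (n : ℕ) (c : ℕ → ℕ → ℤ) : Prop where
  zero_left : ∀ y ≤ n, c 0 y = 0
  zero_right : ∀ x ≤ n, c x 0 = 0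
  top_left : ∀ y ≤ n, c n y = y
  top_right : ∀ x ≤ n, c x n = x
  step_left : ∀ x < n, ∀ y ≤ n, c x y ≤ c (x + 1) y ∧ c (x + 1) y ≤ c x y + 1
  step_right : ∀ x ≤ n, ∀ y < n, c x y ≤ c x (y + 1) ∧ c x (y + 1) ≤ c x y + 1

lemma IsASM.transpose {n : ℕ} {A : Matrix (Fin n) (Fin n) ℤ} (hA : IsASM A) :
    IsASM A.transpose :=
  ⟨fun i j => hA.1 j i, hA.2.2.1, hA.2.1, hA.2.2.2.2, hA.2.2.2.1⟩

lemma IsASM.cornerSum_step_left {n : ℕ} {A : Matrix (Fin n) (Fin n) ℤ} (hA : IsASM A)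
    {x y : ℕ} (hx : x < n) (hy : y ≤ n) :
    cornerSum A x y ≤ cornerSum A (x + 1) y ∧
      cornerSum A (x + 1) y ≤ cornerSum A x y + 1 := by
  have h := (hA.2.2.2.1 ⟨x, hx⟩).prefix_sum_mem (hA.1 _) (hA.2.1 _) hy
  rw [cornerSum_succ_left]
  simp only [entry_of_lt A hx]
  constructor
  · linarith [h.1]
  · linarith [h.2]

lemma IsASM.cornerSum_top_right {n : ℕ} {A : Matrix (Fin n) (Fin n) ℤ} (hA : IsASM A)
    {x : ℕ} (hx : x ≤ n) : cornerSum A x n = x := by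
  induction x with
  | zero => simp [cornerSum]
  | succ x ih =>
    rw [cornerSum_succ_left, ih (by omega)]
    simp only [entry_of_lt A (show x < n by omega), sum_range_extendZero, hA.2.1]
    simp

lemma IsASM.isCornerSum {n : ℕ} {A : Matrix (Fin n) (Fin n) ℤ} (hA : IsASM A) :
    IsCornerSum n (cornerSum A) where
  zero_left _ _ := by simp [cornerSum]
  zero_right _ _ := by simp [cornerSum]
  top_left y hy := by
    rw [← cornerSum_transpose]
    exact hA.transpose.cornerSum_top_right hy
  top_right x hx := hA.cornerSum_top_right hx
  step_left x hx y hy := hA.cornerSum_step_left hx hy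
  step_right x hx y hy := by
    simp only [← cornerSum_transpose A]
    exact hA.transpose.cornerSum_step_left hy hx

/-- The matrix of mixed second differences of a function. -/
def mixedDiff (n : ℕ) (c : ℕ → ℕ → ℤ) : Matrix (Fin n) (Fin n) ℤ :=
  Matrix.of fun i j => c (i + 1) (j + 1) - c i (j + 1) - (c (i + 1) j - c i j)

lemma IsCornerSum.swap {n : ℕ} {c : ℕ → ℕ → ℤ} (hc : IsCornerSum n c) :
    IsCornerSum n fun x y => c y x where
  zero_left := hc.zero_right
  zero_right := hc.zero_left
  top_left := hc.top_right
  top_right := hc.top_left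
  step_left x hx y hy := hc.step_right y hy x hx
  step_right x hx y hy := hc.step_left y hy x hx

lemma mixedDiff_swap (n : ℕ) (c : ℕ → ℕ → ℤ) :
    mixedDiff n (fun x y => c y x) = (mixedDiff n c).transpose := by
  ext i j
  simp only [mixedDiff, Matrix.of_apply, Matrix.transpose_apply]
  ring

lemma IsCornerSum.sum_range_mixedDiff {n : ℕ} {c : ℕ → ℕ → ℤ} (hc : IsCornerSum n c)
    (i : Fin n) {l : ℕ} (hl : l ≤ n) :
    ∑ j ∈ range l, extendZero (mixedDiff n c i) j = c (i + 1) l - c i l := by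
  induction l with
  | zero => simp [hc.zero_right i (by omega), hc.zero_right (i + 1) (by omega)]
  | succ l ih =>
    rw [Finset.sum_range_succ, ih (by omega), extendZero, dif_pos (by omega)]
    simp [mixedDiff]

lemma IsCornerSum.cornerSum_mixedDiff {n : ℕ} {c : ℕ → ℕ → ℤ} (hc : IsCornerSum n c)
    {x y : ℕ} (hx : x ≤ n) (hy : y ≤ n) : cornerSum (mixedDiff n c) x y = c x y := by
  induction x with
  | zero => simp [cornerSum, hc.zero_left y hy]
  | succ x ih =>
    have hx' : x < n := by omega
    rw [cornerSum_succ_left, ih (by omega)]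
    simp only [entry_of_lt _ hx', hc.sum_range_mixedDiff ⟨x, hx'⟩ hy]
    ring

lemma IsCornerSum.mixedDiff_row {n : ℕ} {c : ℕ → ℕ → ℤ} (hc : IsCornerSum n c)
    (i : Fin n) : ∑ j, mixedDiff n c i j = 1 ∧ Alternating (mixedDiff n c i) := by
  constructor
  · rw [← sum_range_extendZero, hc.sum_range_mixedDiff i le_rfl,
      hc.top_right _ (by omega), hc.top_right _ (by omega)]
    simp
  · refine alternating_of_prefix_sum_mem fun l hl => ?_
    rw [hc.sum_range_mixedDiff i hl]
    have := hc.step_left i i.2 l hl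
    omega

lemma IsCornerSum.isASM_mixedDiff {n : ℕ} {c : ℕ → ℕ → ℤ} (hc : IsCornerSum n c) :
    IsASM (mixedDiff n c) := by
  have hcol : ∀ j, ∑ i, mixedDiff n c i j = 1 ∧ Alternating fun i => mixedDiff n c i j := by
    intro j
    have := hc.swap.mixedDiff_row j
    rw [mixedDiff_swap] at this
    exact this
  refine ⟨fun i j => ?_, fun i => (hc.mixedDiff_row i).1, fun j => (hcol j).1,
    fun i => (hc.mixedDiff_row i).2, fun j => (hcol j).2⟩
  have h1 := hc.step_left i i.2 j (by omega)
  have h2 := hc.step_left i i.2 (j + 1) (by omega)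
  simp only [mixedDiff, Matrix.of_apply]
  omega

lemma mixedDiff_cornerSum {n : ℕ} (A : Matrix (Fin n) (Fin n) ℤ) :
    mixedDiff n (cornerSum A) = A := by
  ext i j
  simp only [mixedDiff, Matrix.of_apply, cornerSum_succ_left, Finset.sum_range_succ, entry_val]
  ring

lemma IsCornerSum.nonneg {n : ℕ} {c : ℕ → ℕ → ℤ} (hc : IsCornerSum n c) {x y : ℕ}
    (hx : x ≤ n) (hy : y ≤ n) : 0 ≤ c x y := by
  induction x with
  | zero => rw [hc.zero_left y hy]
  | succ x ih =>
    have := hc.step_left x (by omega) y hy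
    have := ih (by omega)
    omega

lemma IsCornerSum.le_left {n : ℕ} {c : ℕ → ℕ → ℤ} (hc : IsCornerSum n c) {x y : ℕ}
    (hx : x ≤ n) (hy : y ≤ n) : c x y ≤ x := by
  induction x with
  | zero => simp [hc.zero_left y hy]
  | succ x ih =>
    have := hc.step_left x (by omega) y hy
    have := ih (by omega)
    push_cast
    omega

lemma IsCornerSum.add_le {n : ℕ} {c : ℕ → ℕ → ℤ} (hc : IsCornerSum n c) {x y : ℕ}
    (hx : x ≤ n) (hy : y ≤ n) : (x : ℤ) + y ≤ c x y + n := by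
  induction hx using Nat.decreasingInduction with
  | self => simp [hc.top_left y hy, add_comm]
  | of_succ x hx ih =>
    have := hc.step_left x hx y hy
    push_cast at ih
    omega

lemma asmLe_of_cornerSum_le {n : ℕ} {A B : Matrix (Fin n) (Fin n) ℤ}
    (hA : IsASM A) (hB : IsASM B)
    (h : ∀ x y, 1 ≤ x → x < n → 1 ≤ y → y < n → cornerSum B x y ≤ cornerSum A x y) :
    asmLe A B := by
  intro k l
  rw [Csum_eq_cornerSum, Csum_eq_cornerSum]
  by_cases hk : (k : ℕ) + 1 < n
  · by_cases hl : (l : ℕ) + 1 < n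
    · exact h _ _ (by omega) hk (by omega) hl
    · rw [show (l : ℕ) + 1 = n by omega, hA.isCornerSum.top_right _ hk.le,
        hB.isCornerSum.top_right _ hk.le]
  · rw [show (k : ℕ) + 1 = n by omega, hA.isCornerSum.top_left _ (by omega),
      hB.isCornerSum.top_left _ (by omega)]

lemma asmLe.cornerSum_le {n : ℕ} {A B : Matrix (Fin n) (Fin n) ℤ} (h : asmLe A B) {x y : ℕ}
    (hx : x ≤ n) (hy : y ≤ n) : cornerSum B x y ≤ cornerSum A x y := by
  rcases x with _ | x
  · simp [cornerSum]
  rcases y with _ | y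
  · simp [cornerSum]
  simpa [Csum_eq_cornerSum] using h ⟨x, hx⟩ ⟨y, hy⟩

lemma asmLe.antisymm {n : ℕ} {A B : Matrix (Fin n) (Fin n) ℤ} (h : asmLe A B)
    (h' : asmLe B A) : A = B := by
  have hAB : ∀ x y, x ≤ n → y ≤ n → cornerSum A x y = cornerSum B x y :=
    fun x y hx hy => le_antisymm (h'.cornerSum_le hx hy) (h.cornerSum_le hx hy)
  rw [← mixedDiff_cornerSum A, ← mixedDiff_cornerSum B]
  ext i j
  simp only [mixedDiff, Matrix.of_apply]
  rw [hAB _ _ (by omega) (by omega), hAB _ _ (by omega) (by omega),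
    hAB _ _ (by omega) (by omega), hAB _ _ (by omega) (by omega)]

/-! ### Coordinates on the tetrahedral poset -/

/-- The point over `(x, n - y)` whose height is such that it lies below the surface of a
corner sum function `c` exactly when `c x y ≤ m`. -/
def tetrPoint (n x y m : ℕ) : ℤ × ℤ × ℤ :=
  (x, (n : ℤ) - y, ((n : ℤ) - 1) * ((n : ℤ) - 2) / 2 - n + x + y - 2 * m)

/-- The range of the coordinates of points of the tetrahedral poset. -/
def TetrCoord (n x y m : ℕ) : Prop :=
  x < n ∧ y < n ∧ m < x ∧ m < y ∧ x + y ≤ m + n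

lemma tetrPoint_inj {n x y m x' y' m' : ℕ} (h : tetrPoint n x y m = tetrPoint n x' y' m') :
    x = x' ∧ y = y' ∧ m = m' := by
  simp only [tetrPoint, Prod.mk.injEq] at h
  omega

lemma mem_TetrSet_iff {n : ℕ} {p : ℤ × ℤ × ℤ} :
    p ∈ TetrSet n ↔ ∃ x y m, TetrCoord n x y m ∧ p = tetrPoint n x y m := by
  simp only [TetrSet, TetrCoord, tetrPoint, Set.mem_ofPred_eq]
  generalize ((n : ℤ) - 1) * ((n : ℤ) - 2) / 2 = G
  constructor
  · rintro ⟨i, j, k, hi, hi', hj, hj', hk, hk', rfl⟩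
    refine ⟨i.toNat, (n - j).toNat, (k + max 0 (i - j)).toNat, by omega, ?_⟩
    simp only [Prod.mk.injEq]
    rcases abs_cases (i - j) with h | h <;> omega
  · rintro ⟨x, y, m, h, rfl⟩
    refine ⟨x, n - y, m - max 0 ((x : ℤ) + y - n), by omega, by omega, by omega, by omega,
      by omega, by omega, ?_⟩
    simp only [Prod.mk.injEq, true_and]
    rcases abs_cases ((x : ℤ) - (n - y)) with h | h <;> omega

lemma tetrPoint_mem_TetrSet_iff {n x y m : ℕ} :
    tetrPoint n x y m ∈ TetrSet n ↔ TetrCoord n x y m := by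
  rw [mem_TetrSet_iff]
  constructor
  · rintro ⟨x', y', m', h, he⟩
    obtain ⟨rfl, rfl, rfl⟩ := tetrPoint_inj he
    exact h
  · exact fun h => ⟨x, y, m, h, rfl⟩

lemma tetrStep_tetrPoint_iff {n x y m x' y' m' : ℕ} :
    tetrStep n (tetrPoint n x y m) (tetrPoint n x' y' m') ↔
      TetrCoord n x y m ∧ TetrCoord n x' y' m' ∧
        ((y' = y ∧ (x' = x + 1 ∧ m' = m ∨ x = x' + 1 ∧ m = m' + 1)) ∨
          (x' = x ∧ (y' = y + 1 ∧ m' = m ∨ y = y' + 1 ∧ m = m' + 1))) := by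
  simp only [tetrStep, tetrPoint_mem_TetrSet_iff, and_congr_right_iff]
  intro h h'
  simp only [tetrPoint]
  omega

/-- The points of the tetrahedral poset below the surface of a corner sum function. -/
def lowerSetOf (n : ℕ) (c : ℕ → ℕ → ℤ) : Set (ℤ × ℤ × ℤ) :=
  {p | ∃ x y m : ℕ, TetrCoord n x y m ∧ p = tetrPoint n x y m ∧ c x y ≤ m}

lemma tetrPoint_mem_lowerSetOf_iff {n x y m : ℕ} {c : ℕ → ℕ → ℤ} :
    tetrPoint n x y m ∈ lowerSetOf n c ↔ TetrCoord n x y m ∧ c x y ≤ m := by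
  constructor
  · rintro ⟨x', y', m', h, he, hc⟩
    obtain ⟨rfl, rfl, rfl⟩ := tetrPoint_inj he
    exact ⟨h, hc⟩
  · exact fun h => ⟨x, y, m, h.1, rfl, h.2⟩

lemma IsCornerSum.isLowerSetTetr_lowerSetOf {n : ℕ} {c : ℕ → ℕ → ℤ}
    (hc : IsCornerSum n c) : IsLowerSetTetr n (lowerSetOf n c) := by
  refine ⟨?_, fun p q hpq hq => ?_⟩
  · rintro _ ⟨x, y, m, h, rfl, -⟩
    exact tetrPoint_mem_TetrSet_iff.2 h
  · induction hpq using Relation.ReflTransGen.head_induction_on with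
    | refl => exact hq
    | head hs _ ih =>
      obtain ⟨x, y, m, hp, rfl⟩ := mem_TetrSet_iff.1 hs.1
      obtain ⟨x', y', m', -, rfl⟩ := mem_TetrSet_iff.1 hs.2.1
      obtain ⟨-, hq', hs⟩ := tetrStep_tetrPoint_iff.1 hs
      refine tetrPoint_mem_lowerSetOf_iff.2 ⟨hp, ?_⟩
      have hle := (tetrPoint_mem_lowerSetOf_iff.1 ih).2
      unfold TetrCoord at hp hq'
      rcases hs with ⟨rfl, ⟨rfl, rfl⟩ | ⟨rfl, rfl⟩⟩ | ⟨rfl, ⟨rfl, rfl⟩ | ⟨rfl, rfl⟩⟩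
      · have := hc.step_left x (by omega) y' (by omega)
        omega
      · have := hc.step_left x' (by omega) y' (by omega)
        omega
      · have := hc.step_right x' (by omega) y (by omega)
        omega
      · have := hc.step_right x' (by omega) y' (by omega)
        omega

lemma IsCornerSum.lowerSetOf_subset_iff {n : ℕ} {c c' : ℕ → ℕ → ℤ} (hc : IsCornerSum n c)
    (hc' : IsCornerSum n c') :
    lowerSetOf n c ⊆ lowerSetOf n c' ↔
      ∀ x y, 1 ≤ x → x < n → 1 ≤ y → y < n → c' x y ≤ c x y := by
  constructor
  · intro h x y _ hx _ hy
    by_contra! hlt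
    obtain ⟨m, hm⟩ := Int.eq_ofNat_of_zero_le (hc.nonneg hx.le hy.le)
    have hadd := hc.add_le hx.le hy.le
    have hl := hc'.le_left hx.le hy.le
    have hr := hc'.swap.le_left hy.le hx.le
    have hcoord : TetrCoord n x y m := by
      unfold TetrCoord
      omega
    have := tetrPoint_mem_lowerSetOf_iff.1
      (h (tetrPoint_mem_lowerSetOf_iff.2 ⟨hcoord, hm.le⟩))
    omega
  · rintro h _ ⟨x, y, m, hp, rfl, hm⟩
    refine tetrPoint_mem_lowerSetOf_iff.2 ⟨hp, (h x y ?_ hp.1 ?_ hp.2.1).trans hm⟩ <;>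
    · unfold TetrCoord at hp
      omega

/-! ### The corner sum function of a lower set -/

section LowerSet

variable {n : ℕ} {U : Set (ℤ × ℤ × ℤ)}

/-- The height condition whose least solution is the corner sum attached to `U`. -/
def Covers (n : ℕ) (U : Set (ℤ × ℤ × ℤ)) (x y m : ℕ) : Prop :=
  x ≤ m ∨ y ≤ m ∨ tetrPoint n x y m ∈ U

/-- The corner sum function whose surface bounds the lower set `U`. -/
noncomputable def cornerOf (n : ℕ) (U : Set (ℤ × ℤ × ℤ)) (x y : ℕ) : ℕ :=
  sInf {m | Covers n U x y m}

lemma covers_cornerOf (x y : ℕ) : Covers n U x y (cornerOf n U x y) :=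
  Nat.sInf_mem (s := {m | Covers n U x y m}) ⟨x, Or.inl le_rfl⟩

lemma cornerOf_le {x y m : ℕ} (h : Covers n U x y m) : cornerOf n U x y ≤ m :=
  Nat.sInf_le h

lemma IsLowerSetTetr.coord (hU : IsLowerSetTetr n U) {x y m : ℕ}
    (h : tetrPoint n x y m ∈ U) : TetrCoord n x y m :=
  tetrPoint_mem_TetrSet_iff.1 (hU.1 h)

lemma IsLowerSetTetr.mem_of_step (hU : IsLowerSetTetr n U) {x y m x' y' m' : ℕ}
    (h : tetrPoint n x' y' m' ∈ U) (hp : TetrCoord n x y m)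
    (hs : (y' = y ∧ (x' = x + 1 ∧ m' = m ∨ x = x' + 1 ∧ m = m' + 1)) ∨
      (x' = x ∧ (y' = y + 1 ∧ m' = m ∨ y = y' + 1 ∧ m = m' + 1))) :
    tetrPoint n x y m ∈ U :=
  hU.2 _ _ (.single (tetrStep_tetrPoint_iff.2 ⟨hp, hU.coord h, hs⟩)) h

lemma IsLowerSetTetr.covers_of_succ_left (hU : IsLowerSetTetr n U) {x y m : ℕ}
    (h : Covers n U (x + 1) y m) : Covers n U x y m := by
  rcases h with h | h | h
  · exact Or.inl (by omega)
  · exact Or.inr (Or.inl h)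
  · by_cases hx : x ≤ m
    · exact Or.inl hx
    · have hp := hU.coord h
      refine Or.inr (Or.inr (hU.mem_of_step h ?_ (by omega)))
      unfold TetrCoord at hp ⊢
      omega

lemma IsLowerSetTetr.covers_succ_left (hU : IsLowerSetTetr n U) {x y m : ℕ}
    (h : Covers n U x y m) : Covers n U (x + 1) y (m + 1) := by
  rcases h with h | h | h
  · exact Or.inl (by omega)
  · exact Or.inr (Or.inl (by omega))
  · by_cases hy : y ≤ m + 1
    · exact Or.inr (Or.inl hy)
    · have hp := hU.coord h
      refine Or.inr (Or.inr (hU.mem_of_step h ?_ (by omega)))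
      unfold TetrCoord at hp ⊢
      omega

lemma IsLowerSetTetr.covers_of_succ_right (hU : IsLowerSetTetr n U) {x y m : ℕ}
    (h : Covers n U x (y + 1) m) : Covers n U x y m := by
  rcases h with h | h | h
  · exact Or.inl h
  · exact Or.inr (Or.inl (by omega))
  · by_cases hy : y ≤ m
    · exact Or.inr (Or.inl hy)
    · have hp := hU.coord h
      refine Or.inr (Or.inr (hU.mem_of_step h ?_ (by omega)))
      unfold TetrCoord at hp ⊢
      omega

lemma IsLowerSetTetr.covers_succ_right (hU : IsLowerSetTetr n U) {x y m : ℕ}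
    (h : Covers n U x y m) : Covers n U x (y + 1) (m + 1) := by
  rcases h with h | h | h
  · exact Or.inl (by omega)
  · exact Or.inr (Or.inl (by omega))
  · by_cases hx : x ≤ m + 1
    · exact Or.inl hx
    · have hp := hU.coord h
      refine Or.inr (Or.inr (hU.mem_of_step h ?_ (by omega)))
      unfold TetrCoord at hp ⊢
      omega

lemma IsLowerSetTetr.covers_mono (hU : IsLowerSetTetr n U) {x y m m' : ℕ}
    (h : Covers n U x y m) (hm : m ≤ m') : Covers n U x y m' := by
  induction m', hm using Nat.le_induction with
  | base => exact h
  | succ m' _ ih => exact hU.covers_of_succ_left (hU.covers_succ_left ih)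

lemma IsLowerSetTetr.isCornerSum_cornerOf (hU : IsLowerSetTetr n U) :
    IsCornerSum n fun x y => (cornerOf n U x y : ℤ) where
  zero_left y _ := by
    exact_mod_cast Nat.le_zero.1 (cornerOf_le (Or.inl le_rfl))
  zero_right x _ := by
    exact_mod_cast Nat.le_zero.1 (cornerOf_le (Or.inr (Or.inl le_rfl)))
  top_left y hy := by
    refine Int.natCast_inj.2 (le_antisymm (cornerOf_le (Or.inr (Or.inl le_rfl))) ?_)
    rcases covers_cornerOf (n := n) (U := U) n y with h | h | h
    · exact hy.trans h
    · exact h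
    · exact absurd (hU.coord h).1 (lt_irrefl n)
  top_right x hx := by
    refine Int.natCast_inj.2 (le_antisymm (cornerOf_le (Or.inl le_rfl)) ?_)
    rcases covers_cornerOf (n := n) (U := U) x n with h | h | h
    · exact h
    · exact hx.trans h
    · exact absurd (hU.coord h).2.1 (lt_irrefl n)
  step_left x _ y _ := by
    exact_mod_cast And.intro (cornerOf_le (hU.covers_of_succ_left (covers_cornerOf _ _)))
      (cornerOf_le (hU.covers_succ_left (covers_cornerOf x y)))
  step_right x _ y _ := by
    exact_mod_cast And.intro (cornerOf_le (hU.covers_of_succ_right (covers_cornerOf _ _)))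
      (cornerOf_le (hU.covers_succ_right (covers_cornerOf x y)))

lemma IsLowerSetTetr.eq_lowerSetOf (hU : IsLowerSetTetr n U) {c : ℕ → ℕ → ℤ}
    (hc : ∀ x y, x ≤ n → y ≤ n → c x y = cornerOf n U x y) : lowerSetOf n c = U := by
  ext p
  constructor
  · rintro ⟨x, y, m, hp, rfl, hm⟩
    rw [hc x y hp.1.le hp.2.1.le, Nat.cast_le] at hm
    unfold TetrCoord at hp
    rcases hU.covers_mono (covers_cornerOf x y) hm with h | h | h
    · omega
    · omega
    · exact h
  · intro h
    obtain ⟨x, y, m, hp, rfl⟩ := mem_TetrSet_iff.1 (hU.1 h)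
    refine tetrPoint_mem_lowerSetOf_iff.2 ⟨hp, ?_⟩
    rw [hc x y hp.1.le hp.2.1.le, Nat.cast_le]
    exact cornerOf_le (Or.inr (Or.inr h))

end LowerSet

lemma lowerSetOf_cornerSum_subset_iff {n : ℕ} {A B : Matrix (Fin n) (Fin n) ℤ}
    (hA : IsASM A) (hB : IsASM B) :
    lowerSetOf n (cornerSum A) ⊆ lowerSetOf n (cornerSum B) ↔ asmLe A B := by
  rw [hA.isCornerSum.lowerSetOf_subset_iff hB.isCornerSum]
  exact ⟨asmLe_of_cornerSum_le hA hB, fun h x y _ hx _ hy => h.cornerSum_le hx.le hy.le⟩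

/-- The lower set of the tetrahedral poset attached to an alternating sign matrix. -/
def lowerSetOfASM (n : ℕ) (A : {A : Matrix (Fin n) (Fin n) ℤ // IsASM A}) :
    {U : Set (ℤ × ℤ × ℤ) // IsLowerSetTetr n U} :=
  ⟨lowerSetOf n (cornerSum A.1), A.2.isCornerSum.isLowerSetTetr_lowerSetOf⟩

lemma lowerSetOfASM_bijective (n : ℕ) : Function.Bijective (lowerSetOfASM n) := by
  constructor
  · intro A B h
    have h' := congrArg Subtype.val h
    exact Subtype.ext (((lowerSetOf_cornerSum_subset_iff A.2 B.2).1 h'.subset).antisymm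
      ((lowerSetOf_cornerSum_subset_iff B.2 A.2).1 h'.superset))
  · intro U
    have hc := U.2.isCornerSum_cornerOf
    exact ⟨⟨_, hc.isASM_mixedDiff⟩,
      Subtype.ext (U.2.eq_lowerSetOf fun x y hx hy => hc.cornerSum_mixedDiff hx hy)⟩

end ASMPaper

open ASMPaper in
/-- For `n ≥ 2`, the lattice of lower sets of the tetrahedral poset `Tetr_n`, ordered by
inclusion, is order-isomorphic to the lattice `ASM_n` of `n × n` alternating sign
matrices under the partial-sum order. -/
theorem lowerSets_tetr_iso_asm (n : ℕ) (hn : 2 ≤ n) :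
    ∃ F : {U : Set (ℤ × ℤ × ℤ) // IsLowerSetTetr n U} →
          {A : Matrix (Fin n) (Fin n) ℤ // IsASM A},
      Function.Bijective F ∧
      ∀ U V : {U : Set (ℤ × ℤ × ℤ) // IsLowerSetTetr n U},
        U.1 ⊆ V.1 ↔ asmLe (F U).1 (F V).1 := by
  let e := Equiv.ofBijective _ (lowerSetOfASM_bijective n)
  refine ⟨e.symm, e.symm.bijective, fun U V => ?_⟩
  rw [← lowerSetOf_cornerSum_subset_iff (e.symm U).2 (e.symm V).2]
  exact iff_of_eq (congrArg₂ (fun S T : {U : Set (ℤ × ℤ × ℤ) // IsLowerSetTetr n U} =>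
    S.1 ⊆ T.1) (e.apply_symm_apply U) (e.apply_symm_apply V)).symm
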